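/- If u_ε → u₀ in H¹(Ω) as ε → 0⁺, then ∫_Ω |∇(1 − |u_ε|²)|² dx → 0 and ε⁻² ∫_Ω |u_ε|² (1 − |u_ε|²)² dx → 0 as ε → 0⁺. -/

import Mathlib

open MeasureTheory Filter Topology

noncomputable section

/-- Points of the plane, viewed as the Euclidean space `ℝ²`. -/
abbrev Pt : Type := EuclideanSpace ℝ (Fin 2)

/-- The `i`-th partial derivative of a complex-valued function. -/
def pd (u : Pt → ℂ) (x : Pt) (i : Fin 2) : ℂ :=
  fderiv ℝ u x (EuclideanSpace.single i 1)

/-- Squared Hilbert–Schmidt norm of the derivative, `|∇u|²`. -/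
def gradSq (u : Pt → ℂ) (x : Pt) : ℝ :=
  ∑ i, ‖pd u x i‖ ^ 2

/-- `|∇u − ∇v|²`. -/
def gradDiffSq (u v : Pt → ℂ) (x : Pt) : ℝ :=
  ∑ i, ‖pd u x i - pd v x i‖ ^ 2

/-- Laplacian of a complex-valued function. -/
def lap (u : Pt → ℂ) (x : Pt) : ℂ :=
  ∑ i, fderiv ℝ (fun y => pd u y i) x (EuclideanSpace.single i 1)

/-- The `i`-th partial derivative of a real-valued function. -/
def pdR (f : Pt → ℝ) (x : Pt) (i : Fin 2) : ℝ :=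
  fderiv ℝ f x (EuclideanSpace.single i 1)

/-- `|∇f|²` for a real-valued function `f`. -/
def gradSqR (f : Pt → ℝ) (x : Pt) : ℝ :=
  ∑ i, (pdR f x i) ^ 2

/-- Laplacian of a real-valued function. -/
def lapR (f : Pt → ℝ) (x : Pt) : ℝ :=
  ∑ i, fderiv ℝ (fun y => pdR f y i) x (EuclideanSpace.single i 1)

lemma exists_fderiv_bound_of_contDiffOn_closure {F : Type*} [NormedAddCommGroup F]
    [NormedSpace ℝ F] {Ω : Set Pt} (hΩo : IsOpen Ω) (hΩbdd : Bornology.IsBounded Ω)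
    {f : Pt → F} (hf : ContDiffOn ℝ 1 f (closure Ω)) :
    ∃ C, ∀ x ∈ Ω, ‖fderiv ℝ f x‖ ≤ C := by
  have key : ∃ C, ∀ x ∈ closure Ω ∩ Ω, ‖fderiv ℝ f x‖ ≤ C := by
    refine hΩbdd.isCompact_closure.induction_on
      (p := fun s => ∃ C, ∀ x ∈ s ∩ Ω, ‖fderiv ℝ f x‖ ≤ C) ⟨0, by simp⟩ ?_ ?_ ?_
    · rintro s t hst ⟨C, hC⟩
      exact ⟨C, fun x hx => hC x ⟨hst hx.1, hx.2⟩⟩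
    · rintro s t ⟨C, hC⟩ ⟨D, hD⟩
      refine ⟨max C D, fun x hx => ?_⟩
      rcases hx.1 with h | h
      · exact (hC x ⟨h, hx.2⟩).trans (le_max_left _ _)
      · exact (hD x ⟨h, hx.2⟩).trans (le_max_right _ _)
    · intro x hx
      obtain ⟨v, hv, -, -, f', hf', hcont⟩ :=
        (contDiffWithinAt_succ_iff_hasFDerivWithinAt' (n := 0) (by simp)).1
          (show ContDiffWithinAt ℝ (0 + 1) f (closure Ω) x by simpa using hf x hx)
      rw [Set.insert_eq_of_mem hx] at hv
      have hb : ∀ᶠ y in 𝓝[closure Ω] x, ‖f' y‖ < ‖f' x‖ + 1 :=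
        hcont.continuousWithinAt.norm.eventually_lt_const (lt_add_one _)
      refine ⟨v ∩ {y | ‖f' y‖ < ‖f' x‖ + 1}, inter_mem hv hb, ‖f' x‖ + 1, ?_⟩
      rintro y ⟨⟨hyv, hyb⟩, hyΩ⟩
      rw [((hf' y hyv).hasFDerivAt (mem_of_superset (hΩo.mem_nhds hyΩ) subset_closure)).fderiv]
      exact hyb.le
  obtain ⟨C, hC⟩ := key
  exact ⟨C, fun x hx => hC x ⟨subset_closure hx, hx⟩⟩

lemma contDiff_indicator_of_isClosed {Ω K : Set Pt} (hΩo : IsOpen Ω) (hK : IsClosed K)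
    (hKΩ : K ⊆ Ω) {f : Pt → ℝ} (hf : ContDiffOn ℝ 1 f Ω) (h0 : ∀ x ∈ Ω \ K, f x = 0) :
    ContDiff ℝ 1 (Ω.indicator f) := by
  refine contDiff_iff_contDiffAt.2 fun x => ?_
  by_cases hx : x ∈ Ω
  · refine ((hf x hx).contDiffAt (hΩo.mem_nhds hx)).congr_of_eventuallyEq ?_
    filter_upwards [hΩo.mem_nhds hx] with y hy using Set.indicator_of_mem hy f
  · refine (contDiffAt_const (c := (0 : ℝ))).congr_of_eventuallyEq ?_
    filter_upwards [hK.isOpen_compl.mem_nhds fun h => hx (hKΩ h)] with y hy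
    by_cases hyΩ : y ∈ Ω
    · rw [Set.indicator_of_mem hyΩ, h0 y ⟨hyΩ, hy⟩]
    · exact Set.indicator_of_notMem hyΩ f

lemma integrable_fderiv_apply {F : Pt → ℝ} (hF : ContDiff ℝ 1 F) (hc : HasCompactSupport F)
    (v : Pt) : Integrable fun x => fderiv ℝ F x v :=
  Continuous.integrable_of_hasCompactSupport
    ((hF.continuous_fderiv one_ne_zero).clm_apply continuous_const) (hc.fderiv_apply ℝ v)

lemma integral_fderiv_apply_eq_zero {F : Pt → ℝ} (hF : ContDiff ℝ 1 F)
    (hc : HasCompactSupport F) (v : Pt) : ∫ x, fderiv ℝ F x v = 0 := by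
  have h := integral_mul_fderiv_eq_neg_fderiv_mul_of_integrable (μ := (volume : Measure Pt))
    (f := fun _ => (1 : ℝ)) (g := F) (v := v) (by simp)
    (by simpa using integrable_fderiv_apply hF hc v)
    (by simpa using hF.continuous.integrable_of_hasCompactSupport hc)
    (fun x _ => by fun_prop) (fun x _ => hF.differentiable one_ne_zero x)
  simpa using h

/-- A smooth odd truncation of the identity, vanishing where `n * s ^ 2 ≤ 1`. -/
def truncId (n : ℕ) (s : ℝ) : ℝ := Real.smoothTransition (n * s ^ 2 - 1) * s

lemma contDiff_truncId (n : ℕ) : ContDiff ℝ 1 (truncId n) :=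
  ((Real.smoothTransition.contDiff (n := 1)).comp (by fun_prop)).mul contDiff_id

lemma smoothTransition_le_deriv_truncId (n : ℕ) (s : ℝ) :
    Real.smoothTransition (n * s ^ 2 - 1) ≤ deriv (truncId n) s := by
  have hT : HasDerivAt Real.smoothTransition (deriv Real.smoothTransition (n * s ^ 2 - 1))
      (n * s ^ 2 - 1) :=
    ((Real.smoothTransition.contDiff (n := 1)).differentiable (by simp) _).hasDerivAt
  have hin : HasDerivAt (fun t : ℝ => n * t ^ 2 - 1) (n * (2 * s)) s := by
    simpa using (((hasDerivAt_id s).pow 2).const_mul (n : ℝ)).sub_const 1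
  have h : HasDerivAt (truncId n) (deriv Real.smoothTransition (n * s ^ 2 - 1) * (n * (2 * s)) * s
      + Real.smoothTransition (n * s ^ 2 - 1) * 1) s :=
    HasDerivAt.mul (HasDerivAt.comp (h₂ := Real.smoothTransition) s hT hin) (hasDerivAt_id s)
  rw [h.deriv]
  have := Real.smoothTransition.monotone.deriv_nonneg (x := n * s ^ 2 - 1)
  have h2 : 0 ≤ deriv Real.smoothTransition (n * s ^ 2 - 1) * (2 * n * s ^ 2) := by positivity
  linarith

lemma gradSqR_nonneg (f : Pt → ℝ) (x : Pt) : 0 ≤ gradSqR f x :=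
  Finset.sum_nonneg fun _ _ => sq_nonneg _

lemma contDiffOn_pdR {Ω : Set Pt} (hΩo : IsOpen Ω) {w : Pt → ℝ} (hw : ContDiffOn ℝ 2 w Ω)
    (i : Fin 2) : ContDiffOn ℝ 1 (fun x => pdR w x i) Ω :=
  (hw.fderiv_of_isOpen hΩo (by norm_num)).clm_apply contDiffOn_const

/-- Testing against a truncation of `w` itself, for `w` vanishing on the boundary. -/
lemma integral_smoothTransition_mul_le_zero {Ω : Set Pt} (hΩo : IsOpen Ω)
    (hΩbdd : Bornology.IsBounded Ω) {w : Pt → ℝ} (hwc : ContinuousOn w (closure Ω))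
    (hw2 : ContDiffOn ℝ 2 w Ω) (hwb : ∀ x ∈ frontier Ω, w x = 0)
    (hint : IntegrableOn (fun x => gradSqR w x + w x * lapR w x) Ω) (n : ℕ) :
    ∫ x in Ω, Real.smoothTransition (n * w x ^ 2 - 1) * (gradSqR w x + w x * lapR w x) ≤ 0 := by
  set K : Set Pt := closure Ω ∩ w ⁻¹' {s | 1 ≤ n * s ^ 2}
  have hKcl : IsClosed K := hwc.preimage_isClosed_of_isClosed isClosed_closure
    (isClosed_le continuous_const (by fun_prop))
  have hKΩ : K ⊆ Ω := by
    rintro x ⟨hx, hx1⟩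
    by_contra hxΩ
    have := hwb x (by rw [hΩo.frontier_eq]; exact ⟨hx, hxΩ⟩)
    simp only [Set.mem_preimage, this, Set.mem_ofPred_eq] at hx1
    norm_num at hx1
  have hKc : IsCompact K := hΩbdd.isCompact_closure.of_isClosed_subset hKcl Set.inter_subset_left
  set F : Fin 2 → Pt → ℝ := fun i => Ω.indicator fun x => truncId n (w x) * pdR w x i
  have h0 : ∀ i, ∀ x ∈ Ω \ K, truncId n (w x) * pdR w x i = 0 := by
    rintro i x ⟨hx, hxK⟩
    have : ¬ 1 ≤ (n : ℝ) * w x ^ 2 := fun h => hxK ⟨subset_closure hx, h⟩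
    rw [truncId, Real.smoothTransition.zero_of_nonpos (by linarith)]
    simp
  have hFC : ∀ i, ContDiff ℝ 1 (F i) := fun i =>
    contDiff_indicator_of_isClosed hΩo hKcl hKΩ
      (((contDiff_truncId n).comp_contDiffOn (hw2.of_le (by norm_num))).mul
        (contDiffOn_pdR hΩo hw2 i)) (h0 i)
  have hF0 : ∀ i, ∀ x ∉ K, F i x = 0 := by
    intro i x hx
    by_cases hxΩ : x ∈ Ω
    · exact (Set.indicator_of_mem hxΩ _).trans (h0 i x ⟨hxΩ, hx⟩)
    · exact Set.indicator_of_notMem hxΩ _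
  have hFc : ∀ i, HasCompactSupport (F i) := fun i => HasCompactSupport.intro hKc (hF0 i)
  have hd : ∀ x ∈ Ω, ∀ i, fderiv ℝ (F i) x (EuclideanSpace.single i 1) =
      deriv (truncId n) (w x) * pdR w x i ^ 2 +
        truncId n (w x) * fderiv ℝ (fun y => pdR w y i) x (EuclideanSpace.single i 1) := by
    intro x hx i
    have hev : F i =ᶠ[𝓝 x] fun x => truncId n (w x) * pdR w x i := by
      filter_upwards [hΩo.mem_nhds hx] with y hy using Set.indicator_of_mem hy _
    have hw' : HasFDerivAt w (fderiv ℝ w x) x :=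
      ((hw2.differentiableOn (by norm_num)).differentiableAt (hΩo.mem_nhds hx)).hasFDerivAt
    have hp : HasFDerivAt (fun y => pdR w y i) (fderiv ℝ (fun y => pdR w y i) x) x :=
      (((contDiffOn_pdR hΩo hw2 i).differentiableOn (by norm_num)).differentiableAt
        (hΩo.mem_nhds hx)).hasFDerivAt
    have ht : HasDerivAt (truncId n) (deriv (truncId n) (w x)) (w x) :=
      ((contDiff_truncId n).differentiable (by norm_num) _).hasDerivAt
    have hprod : HasFDerivAt (fun x => truncId n (w x) * pdR w x i) _ x :=
      HasFDerivAt.mul (ht.comp_hasFDerivAt x hw') hp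
    rw [hev.fderiv_eq, hprod.fderiv]
    simp only [add_apply, smul_apply, smul_eq_mul, pdR]
    ring
  have hdiv : ∫ x in Ω, ∑ i, fderiv ℝ (F i) x (EuclideanSpace.single i 1) = 0 := by
    rw [setIntegral_eq_integral_of_forall_compl_eq_zero, integral_finsetSum _
      fun i _ => integrable_fderiv_apply (hFC i) (hFc i) _]
    · exact Finset.sum_eq_zero fun i _ => integral_fderiv_apply_eq_zero (hFC i) (hFc i) _
    · intro x hx
      refine Finset.sum_eq_zero fun i _ => ?_
      have : F i =ᶠ[𝓝 x] fun _ => (0 : ℝ) := by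
        filter_upwards [hKcl.isOpen_compl.mem_nhds fun h => hx (hKΩ h)] with y hy
          using hF0 i y hy
      rw [this.fderiv_eq]
      simp
  rw [← hdiv]
  refine setIntegral_mono_on ?_ ?_ hΩo.measurableSet fun x hx => ?_
  · refine hint.bdd_mul (c := 1) ?_ ?_
    · refine ContinuousOn.aestronglyMeasurable ?_ hΩo.measurableSet
      have := hwc.mono subset_closure
      exact Real.smoothTransition.continuous.comp_continuousOn (by fun_prop)
    · filter_upwards with x
      rw [Real.norm_of_nonneg (Real.smoothTransition.nonneg _)]
      exact Real.smoothTransition.le_one _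
  · exact (integrable_finsetSum _
      fun i _ => integrable_fderiv_apply (hFC i) (hFc i) _).integrableOn
  · simp only [hd x hx]
    rw [Finset.sum_add_distrib, ← Finset.mul_sum, ← Finset.mul_sum]
    have h1 := mul_le_mul_of_nonneg_right (smoothTransition_le_deriv_truncId n (w x))
      (gradSqR_nonneg w x)
    have h2 : truncId n (w x) * lapR w x =
      Real.smoothTransition (n * w x ^ 2 - 1) * (w x * lapR w x) := by
      rw [truncId]; ring
    have h3 : ∑ i, pdR w x i ^ 2 = gradSqR w x := rfl
    have h4 : ∑ i, fderiv ℝ (fun y => pdR w y i) x (EuclideanSpace.single i 1) = lapR w x := rfl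
    rw [h3, h4, h2]
    linarith

lemma integral_indicator_ne_zero_le_zero {Ω : Set Pt} (hΩo : IsOpen Ω)
    (hΩbdd : Bornology.IsBounded Ω) {w : Pt → ℝ} (hwc : ContinuousOn w (closure Ω))
    (hw2 : ContDiffOn ℝ 2 w Ω) (hwb : ∀ x ∈ frontier Ω, w x = 0)
    (hint : IntegrableOn (fun x => gradSqR w x + w x * lapR w x) Ω) :
    ∫ x in Ω, {x | w x ≠ 0}.indicator (fun x => gradSqR w x + w x * lapR w x) x ≤ 0 := by
  refine le_of_tendsto (tendsto_integral_of_dominated_convergence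
    (F := fun (n : ℕ) x =>
      Real.smoothTransition (n * w x ^ 2 - 1) * (gradSqR w x + w x * lapR w x))
    (fun x => ‖gradSqR w x + w x * lapR w x‖) ?_ hint.norm ?_ ?_)
    (Eventually.of_forall fun n =>
      integral_smoothTransition_mul_le_zero hΩo hΩbdd hwc hw2 hwb hint n)
  · intro n
    refine AEStronglyMeasurable.mul ?_ hint.aestronglyMeasurable
    refine ContinuousOn.aestronglyMeasurable ?_ hΩo.measurableSet
    have := hwc.mono subset_closure
    exact Real.smoothTransition.continuous.comp_continuousOn (by fun_prop)
  · intro n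
    filter_upwards with x
    rw [norm_mul, Real.norm_of_nonneg (Real.smoothTransition.nonneg _)]
    exact mul_le_of_le_one_left (norm_nonneg _) (Real.smoothTransition.le_one _)
  · filter_upwards with x
    by_cases hx : w x = 0
    · simp [hx, Real.smoothTransition.zero_of_nonpos]
    · rw [Set.indicator_of_mem (show x ∈ {x | w x ≠ 0} from hx)]
      refine tendsto_const_nhds.congr' ?_
      have hpos : 0 < w x ^ 2 := by positivity
      filter_upwards [(tendsto_natCast_atTop_atTop.atTop_mul_const hpos).eventually_ge_atTop 2]
        with n hn
      rw [Real.smoothTransition.one_of_one_le (by linarith), one_mul]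

lemma integrableOn_of_continuousOn_of_bounded {Ω : Set Pt} (hΩo : IsOpen Ω)
    (hΩbdd : Bornology.IsBounded Ω) {f : Pt → ℝ} (hf : ContinuousOn f Ω)
    (hb : ∃ C, ∀ x ∈ Ω, |f x| ≤ C) : IntegrableOn f Ω := by
  obtain ⟨C, hC⟩ := hb
  exact IntegrableOn.of_bound hΩbdd.measure_lt_top
    (hf.aestronglyMeasurable hΩo.measurableSet) C
    ((ae_restrict_iff' hΩo.measurableSet).2 (Eventually.of_forall hC))

lemma exists_abs_bound_of_continuousOn_closure {Ω : Set Pt} (hΩbdd : Bornology.IsBounded Ω)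
    {f : Pt → ℝ} (hf : ContinuousOn f (closure Ω)) : ∃ C, ∀ x ∈ Ω, |f x| ≤ C := by
  obtain ⟨C, hC⟩ := hΩbdd.isCompact_closure.exists_bound_of_continuousOn hf
  exact ⟨C, fun x hx => hC x (subset_closure hx)⟩

lemma gradDiffSq_nonneg (u v : Pt → ℂ) (x : Pt) : 0 ≤ gradDiffSq u v x :=
  Finset.sum_nonneg fun _ _ => sq_nonneg _

lemma gradSq_nonneg (u : Pt → ℂ) (x : Pt) : 0 ≤ gradSq u x :=
  Finset.sum_nonneg fun _ _ => sq_nonneg _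

lemma norm_pd_le (u : Pt → ℂ) (x : Pt) (i : Fin 2) : ‖pd u x i‖ ≤ ‖fderiv ℝ u x‖ := by
  simpa [pd] using (fderiv ℝ u x).le_opNorm (EuclideanSpace.single i 1)

lemma abs_pdR_le (f : Pt → ℝ) (x : Pt) (i : Fin 2) : |pdR f x i| ≤ ‖fderiv ℝ f x‖ := by
  simpa [pdR] using (fderiv ℝ f x).le_opNorm (EuclideanSpace.single i 1)

lemma continuousOn_pd {Ω : Set Pt} (hΩo : IsOpen Ω) {u : Pt → ℂ} (hu : ContDiffOn ℝ 1 u Ω)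
    (i : Fin 2) : ContinuousOn (fun x => pd u x i) Ω :=
  (hu.continuousOn_fderiv_of_isOpen hΩo le_rfl).clm_apply continuousOn_const

lemma exists_gradSq_bound {Ω : Set Pt} (hΩo : IsOpen Ω) (hΩbdd : Bornology.IsBounded Ω)
    {u : Pt → ℂ} (hu : ContDiffOn ℝ 1 u (closure Ω)) : ∃ M, ∀ x ∈ Ω, gradSq u x ≤ M := by
  obtain ⟨C, hC⟩ := exists_fderiv_bound_of_contDiffOn_closure hΩo hΩbdd hu
  refine ⟨∑ _i : Fin 2, C ^ 2, fun x hx => Finset.sum_le_sum fun i _ => ?_⟩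
  have := (norm_pd_le u x i).trans (hC x hx)
  gcongr

lemma integrableOn_gradSq {Ω : Set Pt} (hΩo : IsOpen Ω) (hΩbdd : Bornology.IsBounded Ω)
    {u : Pt → ℂ} (hu : ContDiffOn ℝ 1 u (closure Ω)) : IntegrableOn (gradSq u) Ω := by
  refine integrableOn_of_continuousOn_of_bounded hΩo hΩbdd ?_ ?_
  · exact continuousOn_finsetSum _ fun i _ =>
      (continuousOn_pd hΩo (hu.mono subset_closure) i).norm.pow 2
  · obtain ⟨M, hM⟩ := exists_gradSq_bound hΩo hΩbdd hu
    exact ⟨M, fun x hx => by rw [abs_of_nonneg (gradSq_nonneg u x)]; exact hM x hx⟩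

lemma integrableOn_gradSqR {Ω : Set Pt} (hΩo : IsOpen Ω) (hΩbdd : Bornology.IsBounded Ω)
    {f : Pt → ℝ} (hf : ContDiffOn ℝ 1 f (closure Ω)) : IntegrableOn (gradSqR f) Ω := by
  refine integrableOn_of_continuousOn_of_bounded hΩo hΩbdd ?_ ?_
  · exact continuousOn_finsetSum _ fun i _ =>
      (((hf.mono subset_closure).continuousOn_fderiv_of_isOpen hΩo le_rfl).clm_apply
        continuousOn_const).pow 2
  · obtain ⟨C, hC⟩ := exists_fderiv_bound_of_contDiffOn_closure hΩo hΩbdd hf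
    refine ⟨∑ _i : Fin 2, C ^ 2, fun x hx => ?_⟩
    rw [abs_of_nonneg (gradSqR_nonneg f x)]
    refine Finset.sum_le_sum fun i _ => ?_
    rw [← sq_abs]
    have := (abs_pdR_le f x i).trans (hC x hx)
    gcongr

lemma integrableOn_gradDiffSq {Ω : Set Pt} (hΩo : IsOpen Ω) (hΩbdd : Bornology.IsBounded Ω)
    {u v : Pt → ℂ} (hu : ContDiffOn ℝ 1 u (closure Ω)) (hv : ContDiffOn ℝ 1 v (closure Ω)) :
    IntegrableOn (gradDiffSq u v) Ω := by
  refine (integrableOn_gradSq hΩo hΩbdd (hu.sub hv)).congr_fun (fun x hx => ?_)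
    hΩo.measurableSet
  have hd : ∀ {f : Pt → ℂ}, ContDiffOn ℝ 1 f (closure Ω) → DifferentiableAt ℝ f x := fun hf =>
    ((hf.mono subset_closure).differentiableOn one_ne_zero).differentiableAt (hΩo.mem_nhds hx)
  refine Finset.sum_congr rfl fun i _ => ?_
  rw [pd, fderiv_fun_sub (hd hu) (hd hv)]
  rfl

lemma pdR_one_sub_norm_sq {u : Pt → ℂ} {x : Pt} (hu : DifferentiableAt ℝ u x) (i : Fin 2) :
    pdR (fun y => 1 - ‖u y‖ ^ 2) x i = -2 * inner ℝ (u x) (pd u x i) := by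
  rw [pdR, (hu.hasFDerivAt.norm_sq.const_sub 1).fderiv]
  simp [pd, -Complex.inner]

lemma lapR_one_sub_norm_sq {Ω : Set Pt} (hΩo : IsOpen Ω) {u : Pt → ℂ}
    (hu : ContDiffOn ℝ 2 u Ω) {x : Pt} (hx : x ∈ Ω) :
    lapR (fun y => 1 - ‖u y‖ ^ 2) x = -2 * (gradSq u x + inner ℝ (u x) (lap u x)) := by
  have hd : ∀ y ∈ Ω, DifferentiableAt ℝ u y := fun y hy =>
    (hu.differentiableOn two_ne_zero).differentiableAt (hΩo.mem_nhds hy)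
  rw [lapR, gradSq, lap, inner_sum, ← Finset.sum_add_distrib, Finset.mul_sum]
  refine Finset.sum_congr rfl fun i _ => ?_
  have hev : (fun y => pdR (fun y => 1 - ‖u y‖ ^ 2) y i) =ᶠ[𝓝 x]
      fun y => -2 * inner ℝ (u y) (pd u y i) := by
    filter_upwards [hΩo.mem_nhds hx] with y hy using pdR_one_sub_norm_sq (hd y hy) i
  have hp : DifferentiableAt ℝ (fun y => pd u y i) x :=
    (((hu.fderiv_of_isOpen hΩo (m := 1) (by norm_num)).clm_apply
      contDiffOn_const).differentiableOn one_ne_zero).differentiableAt (hΩo.mem_nhds hx)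
  rw [hev.fderiv_eq, fderiv_const_mul ((hd x hx).inner ℝ hp), smul_apply,
    fderiv_inner_apply ℝ (hd x hx) hp, smul_eq_mul, add_comm (inner ℝ (u x) _)]
  congr 2
  exact real_inner_self_eq_norm_sq _

lemma gradSq_le_two_mul_add (u v : Pt → ℂ) (x : Pt) :
    gradSq u x ≤ 2 * gradDiffSq u v x + 2 * gradSq v x := by
  rw [gradSq, gradDiffSq, gradSq, Finset.mul_sum, Finset.mul_sum, ← Finset.sum_add_distrib]
  refine Finset.sum_le_sum fun i _ => ?_
  have h := norm_add_le (pd u x i - pd v x i) (pd v x i)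
  rw [sub_add_cancel] at h
  nlinarith [norm_nonneg (pd u x i), sq_nonneg (‖pd u x i - pd v x i‖ - ‖pd v x i‖)]

lemma inner_pd_eq_zero_of_norm_eq_one {v : Pt → ℂ} (hv : ∀ y, ‖v y‖ = 1) {x : Pt}
    (hd : DifferentiableAt ℝ v x) (i : Fin 2) : inner ℝ (v x) (pd v x i) = 0 := by
  have h := pdR_one_sub_norm_sq hd i
  simp only [hv, pdR] at h
  simpa using h.symm

/-- Where `|u| = 1`, the gradient of `|u|²` is controlled by the distance of `u` to an
`S¹`-valued map. -/
lemma gradSqR_one_sub_norm_sq_le {u v : Pt → ℂ} (hv : ∀ y, ‖v y‖ = 1) {x : Pt}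
    (hux : ‖u x‖ = 1) (hdu : DifferentiableAt ℝ u x) (hdv : DifferentiableAt ℝ v x) :
    gradSqR (fun y => 1 - ‖u y‖ ^ 2) x ≤
      8 * gradDiffSq u v x + 8 * (‖u x - v x‖ ^ 2 * gradSq v x) := by
  rw [gradSqR, gradDiffSq, gradSq, Finset.mul_sum, Finset.mul_sum, Finset.mul_sum,
    ← Finset.sum_add_distrib]
  refine Finset.sum_le_sum fun i _ => ?_
  rw [pdR_one_sub_norm_sq hdu]
  have h0 := inner_pd_eq_zero_of_norm_eq_one hv hdv i
  have h1 : inner ℝ (u x) (pd u x i) =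
      inner ℝ (u x) (pd u x i - pd v x i) + inner ℝ (u x - v x) (pd v x i) := by
    rw [inner_sub_right, inner_sub_left, h0]; ring
  have h2 := abs_real_inner_le_norm (u x) (pd u x i - pd v x i)
  have h3 := abs_real_inner_le_norm (u x - v x) (pd v x i)
  rw [hux, one_mul] at h2
  have h4 := sq_le_sq' (abs_le.1 h2).1 (abs_le.1 h2).2
  have h5 := sq_le_sq' (abs_le.1 h3).1 (abs_le.1 h3).2
  rw [h1]
  rw [mul_pow] at h5
  nlinarith [sq_nonneg (inner ℝ (u x) (pd u x i - pd v x i) - inner ℝ (u x - v x) (pd v x i))]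

lemma ginzburgLandau_energy_le {Ω : Set Pt} (hΩo : IsOpen Ω) (hΩbdd : Bornology.IsBounded Ω)
    {u v : Pt → ℂ} {c M t : ℝ} (ht : 0 < t) (hM0 : 0 ≤ M)
    (hv : ∀ y, ‖v y‖ = 1) (hv1 : ContDiffOn ℝ 1 v (closure Ω))
    (hM : ∀ x ∈ Ω, gradSq v x ≤ M)
    (hu1 : ContDiffOn ℝ 1 u (closure Ω)) (hu2 : ContDiffOn ℝ 2 u Ω)
    (hGL : ∀ x ∈ Ω, -(lap u x) = (c : ℂ) * u x * ((1 - ‖u x‖ ^ 2 : ℝ) : ℂ))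
    (hub : ∀ x ∈ frontier Ω, ‖u x‖ = 1) :
    (∫ x in Ω, gradSqR (fun y => 1 - ‖u y‖ ^ 2) x) +
        2 * (c * ∫ x in Ω, ‖u x‖ ^ 2 * (1 - ‖u x‖ ^ 2) ^ 2) ≤
      8 * (∫ x in Ω, gradDiffSq u v x) + 4 * M * t * volume.real Ω +
        (4 * M / t + 8 * M) * ∫ x in Ω, ‖u x - v x‖ ^ 2 := by
  set w : Pt → ℝ := fun y => 1 - ‖u y‖ ^ 2 with hw
  have hw1 : ContDiffOn ℝ 1 w (closure Ω) := contDiffOn_const.sub (hu1.norm_sq ℝ)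
  have hw2 : ContDiffOn ℝ 2 w Ω := contDiffOn_const.sub (hu2.norm_sq ℝ)
  have huc := hu1.continuousOn
  have hvc := hv1.continuousOn
  have hwc := hw1.continuousOn
  have hint {f : Pt → ℝ} (hf : ContinuousOn f (closure Ω)) : IntegrableOn f Ω :=
    (hf.integrableOn_compact hΩbdd.isCompact_closure).mono_set subset_closure
  have hiD := integrableOn_gradDiffSq hΩo hΩbdd hu1 hv1
  have hiG := integrableOn_gradSqR hΩo hΩbdd hw1
  have hiP : IntegrableOn (fun x => ‖u x‖ ^ 2 * w x ^ 2) Ω := hint (by fun_prop)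
  have hid : IntegrableOn (fun x => ‖u x - v x‖ ^ 2) Ω := hint (by fun_prop)
  have hlap : ∀ x ∈ Ω, gradSqR w x + w x * lapR w x =
      gradSqR w x + 2 * (c * (‖u x‖ ^ 2 * w x ^ 2)) - 2 * (gradSq u x * w x) := by
    intro x hx
    have hin : inner ℝ (u x) (lap u x) = -(c * ‖u x‖ ^ 2 * w x) := by
      have h : lap u x = (-(c * w x)) • u x := by
        rw [← neg_neg (lap u x), hGL x hx, Complex.real_smul]
        simp only [hw]
        push_cast
        ring
      rw [h, inner_smul_right, real_inner_self_eq_norm_sq]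
      ring
    rw [show lapR w x = _ from lapR_one_sub_norm_sq hΩo hu2 hx, hin]
    ring
  have hiU : IntegrableOn (fun x => gradSq u x * w x) Ω := by
    obtain ⟨C, hC⟩ := exists_abs_bound_of_continuousOn_closure hΩbdd hwc
    refine (integrableOn_gradSq hΩo hΩbdd hu1).mul_bdd (c := C)
      ((hwc.mono subset_closure).aestronglyMeasurable hΩo.measurableSet) ?_
    exact (ae_restrict_iff' hΩo.measurableSet).2 (Eventually.of_forall hC)
  have hiT : IntegrableOn (fun x => gradSqR w x + w x * lapR w x) Ω :=
    ((hiG.add ((hiP.const_mul c).const_mul 2)).sub (hiU.const_mul 2)).congr_fun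
      (fun x hx => (hlap x hx).symm) hΩo.measurableSet
  have hle := integral_indicator_ne_zero_le_zero hΩo hΩbdd hwc hw2
    (fun x hx => by simp [hw, hub x hx]) hiT
  have hiI : IntegrableOn
      ({x | w x ≠ 0}.indicator fun x => gradSqR w x + w x * lapR w x) Ω := by
    have hopen : IsOpen (Ω ∩ w ⁻¹' {0}ᶜ) :=
      (hwc.mono subset_closure).isOpen_inter_preimage hΩo isOpen_compl_singleton
    refine IntegrableOn.congr_fun (hiT.indicator hopen.measurableSet) (fun x hx => ?_)
      hΩo.measurableSet
    by_cases hwx : w x = 0 <;> simp [Set.indicator, hwx, hx]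
  have hpt : ∀ x ∈ Ω, gradSqR w x + 2 * (c * (‖u x‖ ^ 2 * w x ^ 2)) ≤
      {x | w x ≠ 0}.indicator (fun x => gradSqR w x + w x * lapR w x) x +
        (8 * gradDiffSq u v x + 4 * M * t + (4 * M / t + 8 * M) * ‖u x - v x‖ ^ 2) := by
    intro x hx
    have hd {f : Pt → ℂ} (hf : ContDiffOn ℝ 1 f (closure Ω)) : DifferentiableAt ℝ f x :=
      ((hf.mono subset_closure).differentiableOn one_ne_zero).differentiableAt (hΩo.mem_nhds hx)
    have hD := gradDiffSq_nonneg u v x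
    have hv0 := gradSq_nonneg v x
    have hMx := hM x hx
    have hMt : 0 ≤ 4 * M / t * ‖u x - v x‖ ^ 2 := by positivity
    by_cases hwx : w x = 0
    · have hux : ‖u x‖ = 1 := by
        have : ‖u x‖ ^ 2 = 1 := by simp only [hw] at hwx; linarith
        exact (pow_eq_one_iff_of_nonneg (norm_nonneg _) two_ne_zero).1 this
      have h := gradSqR_one_sub_norm_sq_le hv hux (hd hu1) (hd hv1)
      have h' := mul_le_mul_of_nonneg_left hMx (sq_nonneg ‖u x - v x‖)
      have h'' : 0 ≤ 4 * M * t := by positivity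
      rw [Set.indicator_of_notMem (by simpa using hwx), hwx]
      linarith
    · rw [Set.indicator_of_mem (show x ∈ {x | w x ≠ 0} from hwx), hlap x hx]
      have hUle := gradSq_le_two_mul_add u v x
      have hU0 := gradSq_nonneg u x
      have hw1' : w x ≤ 1 := by simp only [hw]; linarith [sq_nonneg ‖u x‖]
      have hwd : w x ≤ t + ‖u x - v x‖ ^ 2 / t := by
        have h1 : w x ≤ 2 * ‖u x - v x‖ := by
          have := norm_sub_norm_le (v x) (u x)
          rw [hv, norm_sub_rev] at this
          simp only [hw]
          nlinarith [norm_nonneg (u x), norm_nonneg (u x - v x), sq_nonneg (‖u x‖ - 1)]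
        refine h1.trans ?_
        rw [← sub_nonneg, show t + ‖u x - v x‖ ^ 2 / t - 2 * ‖u x - v x‖ =
          (t - ‖u x - v x‖) ^ 2 / t by field_simp; ring]
        positivity
      have hS : 0 ≤ t + ‖u x - v x‖ ^ 2 / t := by positivity
      have hkey : gradSq u x * w x ≤
          2 * gradDiffSq u v x + 2 * (M * (t + ‖u x - v x‖ ^ 2 / t)) := by
        rcases le_or_gt (w x) 0 with hneg | hpos
        · have := mul_nonpos_of_nonneg_of_nonpos hU0 hneg
          have := mul_nonneg hM0 hS
          linarith
        · calc gradSq u x * w x ≤ (2 * gradDiffSq u v x + 2 * gradSq v x) * w x := by gcongr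
            _ = 2 * (gradDiffSq u v x * w x) + 2 * (gradSq v x * w x) := by ring
            _ ≤ 2 * (gradDiffSq u v x * 1) +
                2 * (M * (t + ‖u x - v x‖ ^ 2 / t)) := by gcongr
            _ = _ := by ring
      have e : M * (t + ‖u x - v x‖ ^ 2 / t) * 4 =
          4 * M * t + 4 * M / t * ‖u x - v x‖ ^ 2 := by ring
      have : 0 ≤ 8 * M * ‖u x - v x‖ ^ 2 := by positivity
      linarith
  have hi₁ : IntegrableOn (fun x => 8 * gradDiffSq u v x) Ω := hiD.const_mul 8
  have hi₂ : IntegrableOn (fun x => 8 * gradDiffSq u v x + 4 * M * t) Ω :=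
    hi₁.add (hint continuousOn_const)
  have hi₃ : IntegrableOn (fun x => (4 * M / t + 8 * M) * ‖u x - v x‖ ^ 2) Ω := hid.const_mul _
  have hiR : IntegrableOn (fun x => 8 * gradDiffSq u v x + 4 * M * t +
      (4 * M / t + 8 * M) * ‖u x - v x‖ ^ 2) Ω := hi₂.add hi₃
  have hi₄ : IntegrableOn (fun x => 2 * (c * (‖u x‖ ^ 2 * w x ^ 2))) Ω :=
    (hiP.const_mul c).const_mul 2
  have h := setIntegral_mono_on (hiG.add hi₄) (hiI.add hiR) hΩo.measurableSet hpt
  simp only [Pi.add_apply] at h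
  rw [integral_add hiG hi₄, integral_add hiI hiR, integral_add hi₂ hi₃,
    integral_add hi₁ (hint continuousOn_const)] at h
  simp only [integral_const_mul, setIntegral_const, smul_eq_mul] at h
  linarith

/-- From the proof of Lemma 2.4: `H¹` convergence of `u_ε` to `u₀` implies both
`∫ |∇(1 − |u_ε|²)|² → 0` and `ε⁻² ∫ |u_ε|² (1 − |u_ε|²)² → 0`. -/
theorem stmt9
    (Ω : Set Pt) (hΩo : IsOpen Ω) (hΩne : Ω.Nonempty) (hΩconn : IsConnected Ω)
    (hΩbdd : Bornology.IsBounded Ω)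
    (g : Pt → ℂ) (hg : ∀ x ∈ frontier Ω, ‖g x‖ = 1)
    (φ : Pt → ℝ) (hφ1 : ContDiffOn ℝ 1 φ (closure Ω)) (hφ2 : ContDiffOn ℝ 2 φ Ω)
    (hφharm : ∀ x ∈ Ω, lapR φ x = 0)
    (u₀ : Pt → ℂ) (hu₀ : ∀ x, u₀ x = Complex.exp (Complex.I * (φ x : ℂ)))
    (hu₀b : ∀ x ∈ frontier Ω, u₀ x = g x)
    (u : ℝ → Pt → ℂ)
    (hu1 : ∀ ε > 0, ContDiffOn ℝ 1 (u ε) (closure Ω))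
    (hu2 : ∀ ε > 0, ContDiffOn ℝ 2 (u ε) Ω)
    (hGL : ∀ ε > 0, ∀ x ∈ Ω,
      -(lap (u ε) x) = ((ε ^ 2 : ℝ) : ℂ)⁻¹ * u ε x * ((1 - ‖u ε x‖ ^ 2 : ℝ) : ℂ))
    (hub : ∀ ε > 0, ∀ x ∈ frontier Ω, u ε x = g x)
    (hpoho : ∃ γ₀ > 0, ∀ᶠ ε in 𝓝[>] (0 : ℝ),
      (ε ^ 2)⁻¹ * (∫ x in Ω, (1 - ‖u ε x‖ ^ 2) ^ 2) ≤ γ₀)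
    (hH1a : Tendsto (fun ε => ∫ x in Ω, ‖u ε x - u₀ x‖ ^ 2) (𝓝[>] (0 : ℝ)) (𝓝 0))
    (hH1b : Tendsto (fun ε => ∫ x in Ω, gradDiffSq (u ε) u₀ x) (𝓝[>] (0 : ℝ)) (𝓝 0)) :
    Tendsto (fun ε => ∫ x in Ω, gradSqR (fun y => 1 - ‖u ε y‖ ^ 2) x)
        (𝓝[>] (0 : ℝ)) (𝓝 0) ∧
      Tendsto (fun ε => (ε ^ 2)⁻¹ * ∫ x in Ω, ‖u ε x‖ ^ 2 * (1 - ‖u ε x‖ ^ 2) ^ 2)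
        (𝓝[>] (0 : ℝ)) (𝓝 0) := by
  have hu₀n : ∀ x, ‖u₀ x‖ = 1 := fun x => by
    rw [hu₀, mul_comm, Complex.norm_exp_ofReal_mul_I]
  have hu₀1 : ContDiffOn ℝ 1 u₀ (closure Ω) := by
    rw [show u₀ = fun x => Complex.exp (Complex.I * (φ x : ℂ)) from funext hu₀]
    exact (contDiffOn_const.mul (Complex.ofRealCLM.contDiff.comp_contDiffOn hφ1)).cexp
  obtain ⟨M, hM⟩ := exists_gradSq_bound hΩo hΩbdd hu₀1
  have hM0 : 0 ≤ M := by
    obtain ⟨x, hx⟩ := hΩne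
    exact (gradSq_nonneg u₀ x).trans (hM x hx)
  set D : ℝ → ℝ := fun ε => ∫ x in Ω, gradDiffSq (u ε) u₀ x
  set a : ℝ → ℝ := fun ε => ∫ x in Ω, ‖u ε x - u₀ x‖ ^ 2
  set B : ℝ → ℝ := fun ε =>
    8 * D ε + 4 * M * (√(a ε) + ε) * volume.real Ω + 4 * M * √(a ε) + 8 * M * a ε
  have hε : Tendsto (fun ε : ℝ => ε) (𝓝[>] (0 : ℝ)) (𝓝 0) := tendsto_nhdsWithin_of_tendsto_nhds
    tendsto_id
  have hs : Tendsto (fun ε => √(a ε)) (𝓝[>] (0 : ℝ)) (𝓝 0) := by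
    simpa using hH1a.sqrt
  have hB : Tendsto B (𝓝[>] (0 : ℝ)) (𝓝 0) := by
    have := (((hH1b.const_mul 8).add (((hs.add hε).const_mul (4 * M)).mul_const
      (volume.real Ω))).add (hs.const_mul (4 * M))).add (hH1a.const_mul (8 * M))
    simpa using this
  have hle : ∀ ε > 0, (∫ x in Ω, gradSqR (fun y => 1 - ‖u ε y‖ ^ 2) x) +
      2 * ((ε ^ 2)⁻¹ * ∫ x in Ω, ‖u ε x‖ ^ 2 * (1 - ‖u ε x‖ ^ 2) ^ 2) ≤ B ε := by
    intro ε hε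
    have ha : 0 ≤ a ε := integral_nonneg fun x => sq_nonneg _
    have ht : 0 < √(a ε) + ε := add_pos_of_nonneg_of_pos (Real.sqrt_nonneg _) hε
    refine (ginzburgLandau_energy_le hΩo hΩbdd ht hM0 hu₀n hu₀1 hM
      (hu1 ε hε) (hu2 ε hε) (fun x hx => by rw [hGL ε hε x hx, Complex.ofReal_inv])
      (fun x hx => by rw [hub ε hε x hx, hg x hx])).trans ?_
    have hdiv : 4 * M / (√(a ε) + ε) * a ε ≤ 4 * M * √(a ε) := by
      rw [div_mul_eq_mul_div, div_le_iff₀ ht]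
      have h1 := Real.mul_self_sqrt ha
      have h2 : 0 ≤ M * √(a ε) * ε := by positivity
      nlinarith
    simp only [B]
    linarith
  have hG0 : ∀ ε, 0 ≤ ∫ x in Ω, gradSqR (fun y => 1 - ‖u ε y‖ ^ 2) x := fun ε =>
    integral_nonneg fun x => gradSqR_nonneg _ x
  have hP0 : ∀ ε : ℝ, 0 ≤ (ε ^ 2)⁻¹ * ∫ x in Ω, ‖u ε x‖ ^ 2 * (1 - ‖u ε x‖ ^ 2) ^ 2 := fun ε =>
    mul_nonneg (by positivity) (integral_nonneg fun x => by positivity)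
  constructor
  · refine tendsto_of_tendsto_of_tendsto_of_le_of_le' tendsto_const_nhds hB
      (Eventually.of_forall hG0) ?_
    filter_upwards [self_mem_nhdsWithin] with ε hε
    linarith [hle ε hε, hP0 ε]
  · refine tendsto_of_tendsto_of_tendsto_of_le_of_le' tendsto_const_nhds hB
      (Eventually.of_forall hP0) ?_
    filter_upwards [self_mem_nhdsWithin] with ε hε
    linarith [hle ε hε, hG0 ε, hP0 ε]
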